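/- arXiv:2002.02508 — 7 statements merged into one kernel-verified Lean document; each statement's English description precedes it below -/
import Mathlib

section
/- DQ-GD trajectory lemma (varying stepsize). Let f : E → ℝ be differentiable and let η : ℕ → ℝ be stepsizes with η_t > 0 for all t. Suppose sequences x̂, u, q, e : ℕ → E satisfy: u_0 = ∇f(x̂_0); for every t ≥ 1, u_t = ∇f(x̂_t + η_{t−1}·e_{t−1}) − (η_{t−1}/η_t)·e_{t−1}; for every t ≥ 0, e_t = q_t − u_t and x̂_{t+1} = x̂_t − η_t·q_t (the vectors q_t are arbitrary). Let x : ℕ → E be the unquantized gradient-descent trajectory with the same stepsizes: x_0 = x̂_0 and x_{t+1} = x_t − η_t·∇f(x_t). Then for every t ≥ 1, x̂_t = x_t − η_{t−1}·e_{t−1}. -/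
/-- DQ-GD trajectory lemma with varying stepsizes. -/
theorem dqgd_trajectory_varying_stepsize (n : ℕ) (hn : 1 ≤ n)
    (f : EuclideanSpace ℝ (Fin n) → ℝ) (hf : Differentiable ℝ f)
    (η : ℕ → ℝ) (hη : ∀ t, 0 < η t)
    (xh u q e : ℕ → EuclideanSpace ℝ (Fin n))
    (hu0 : u 0 = gradient f (xh 0))
    (hu : ∀ t : ℕ, u (t + 1) =
      gradient f (xh (t + 1) + η t • e t) - (η t / η (t + 1)) • e t)
    (he : ∀ t : ℕ, e t = q t - u t)
    (hxh : ∀ t : ℕ, xh (t + 1) = xh t - η t • q t)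
    (x : ℕ → EuclideanSpace ℝ (Fin n))
    (hx0 : x 0 = xh 0)
    (hx : ∀ t : ℕ, x (t + 1) = x t - η t • gradient f (x t)) :
    ∀ t : ℕ, xh (t + 1) = x (t + 1) - η t • e t := by
  have hq (t : ℕ) : q t = e t + u t := by rw [he t, sub_add_cancel]
  intro t
  induction t with
  | zero => rw [hxh, hx, hx0, hq, hu0]; module
  | succ t ih =>
    have h_shift : xh (t + 1) + η t • e t = x (t + 1) := by rw [ih, sub_add_cancel]
    have h_scale : η (t + 1) • (η t / η (t + 1)) • e t = η t • e t := by
      rw [smul_smul, mul_div_cancel₀ _ (hη (t + 1)).ne']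
    rw [hxh, hx, hq, hu, h_shift, smul_add, smul_sub, h_scale, ih]
    module
end

section
/- DQ-GD quantization-error bound. Under the DQ-GD algorithm, for every t ≥ 0 one has ‖u_t‖ ≤ r_t and ‖e_t‖ ≤ ε·r_t; moreover r_t = L·D·Σ_{τ=0}^{t} σ_GD^τ·ε^{t−τ}, and consequently ‖e_t‖ ≤ max{σ_GD, ε}^{t+1}·L·D·b_t, where b_t := ε/|σ_GD − ε| if σ_GD ≠ ε and b_t := t + 1 if σ_GD = ε. -/
section GradientStep

variable {E : Type*} [NormedAddCommGroup E] [InnerProductSpace ℝ E]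

theorem norm_add_smul_sq_real (x v : E) (t : ℝ) :
    ‖x + t • v‖ ^ 2 = ‖x‖ ^ 2 + 2 * t * inner ℝ x v + t ^ 2 * ‖v‖ ^ 2 := by
  rw [norm_add_sq_real, real_inner_smul_right, norm_smul, mul_pow, Real.norm_eq_abs, sq_abs]
  ring

variable [CompleteSpace E]

theorem hasDerivAt_comp_line {f : E → ℝ} (hf : Differentiable ℝ f) (x v : E) (t : ℝ) :
    HasDerivAt (fun s : ℝ => f (x + s • v)) (inner ℝ (gradient f (x + t • v)) v) t := by
  have h1 : HasDerivAt (fun s : ℝ => x + s • v) v t := by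
    simpa using ((hasDerivAt_id t).smul_const v).const_add x
  have h2 := (hf (x + t • v)).hasGradientAt.hasFDerivAt.comp_hasDerivAt t h1
  exact h2

/-- The descent lemma: quadratic upper bound for a function with Lipschitz gradient. -/
theorem le_add_inner_gradient_add_sq {f : E → ℝ} {L : ℝ} (hf : Differentiable ℝ f)
    (hsmooth : ∀ x y : E, ‖gradient f x - gradient f y‖ ≤ L * ‖x - y‖) (x v : E) :
    f (x + v) ≤ f x + inner ℝ (gradient f x) v + L / 2 * ‖v‖ ^ 2 := by
  have hd : ∀ t : ℝ, HasDerivAt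
      (fun s : ℝ => f (x + s • v) - s * inner ℝ (gradient f x) v - s ^ 2 * (L / 2 * ‖v‖ ^ 2))
      (inner ℝ (gradient f (x + t • v)) v - inner ℝ (gradient f x) v - t * (L * ‖v‖ ^ 2)) t := by
    intro t
    refine (((hasDerivAt_comp_line hf x v t).sub
      ((hasDerivAt_id t).mul_const (inner ℝ (gradient f x) v))).sub
      (((hasDerivAt_id t).pow 2).mul_const (L / 2 * ‖v‖ ^ 2))).congr_deriv ?_
    simp only [id_eq]
    norm_num
    ring
  have hanti := antitoneOn_of_deriv_nonpos (convex_Icc (0 : ℝ) 1)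
    (fun t _ => (hd t).continuousAt.continuousWithinAt)
    (fun t _ => (hd t).differentiableAt.differentiableWithinAt) (by
      intro t ht
      rw [interior_Icc] at ht
      rw [(hd t).deriv, ← inner_sub_left]
      have h1 := real_inner_le_norm (gradient f (x + t • v) - gradient f x) v
      have h2 := hsmooth (x + t • v) x
      rw [add_sub_cancel_left, norm_smul, Real.norm_of_nonneg ht.1.le] at h2
      have h3 := mul_le_mul_of_nonneg_right h2 (norm_nonneg v)
      linarith)
  have h := hanti (Set.left_mem_Icc.2 zero_le_one) (Set.right_mem_Icc.2 zero_le_one) zero_le_one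
  simp only [one_smul, zero_smul, add_zero] at h
  linarith

/-- Quadratic lower bound for a differentiable strongly convex function. -/
theorem add_inner_gradient_add_sq_le {f : E → ℝ} {μ : ℝ} (hf : Differentiable ℝ f)
    (hconv : ConvexOn ℝ Set.univ (fun x : E => f x - μ / 2 * ‖x‖ ^ 2)) (x v : E) :
    f x + inner ℝ (gradient f x) v + μ / 2 * ‖v‖ ^ 2 ≤ f (x + v) := by
  have hc : ConvexOn ℝ Set.univ
      (fun s : ℝ => f (x + s • v) - μ / 2 * ‖x + s • v‖ ^ 2) := by
    have h := hconv.comp_affineMap (AffineMap.lineMap x (x + v) : ℝ →ᵃ[ℝ] E)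
    simpa [Function.comp_def, AffineMap.lineMap_apply, add_comm] using h
  have hd : HasDerivAt (fun s : ℝ => f (x + s • v) - μ / 2 * ‖x + s • v‖ ^ 2)
      (inner ℝ (gradient f x) v - μ * inner ℝ x v) 0 := by
    simp only [norm_add_smul_sq_real]
    have h0 : HasDerivAt (fun s : ℝ => μ / 2 *
        (‖x‖ ^ 2 + 2 * s * inner ℝ x v + s ^ 2 * ‖v‖ ^ 2)) (μ * inner ℝ x v) 0 := by
      refine (((((((hasDerivAt_id (0 : ℝ)).const_mul 2).mul_const (inner ℝ x v)).const_add
        (‖x‖ ^ 2)).add (((hasDerivAt_id (0 : ℝ)).pow 2).mul_const (‖v‖ ^ 2))).const_mul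
        (μ / 2))).congr_deriv ?_
      simp only [id_eq]
      norm_num
      ring
    have h1 := hasDerivAt_comp_line hf x v 0
    rw [zero_smul, add_zero] at h1
    exact h1.sub h0
  have h := hc.le_slope_of_hasDerivAt (Set.mem_univ 0) (Set.mem_univ 1) zero_lt_one hd
  simp only [slope_def_field, one_smul, zero_smul, add_zero, sub_zero, div_one,
    norm_add_sq_real, inner_zero_right, norm_zero] at h
  linarith

/-- Co-coercivity of the gradient of the convex function `f - μ / 2 * ‖·‖ ^ 2`. -/
theorem norm_gradient_sub_sq_le {f : E → ℝ} {L μ : ℝ} (hμL : μ ≤ L) (hf : Differentiable ℝ f)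
    (hsmooth : ∀ x y : E, ‖gradient f x - gradient f y‖ ≤ L * ‖x - y‖)
    (hconv : ConvexOn ℝ Set.univ (fun x : E => f x - μ / 2 * ‖x‖ ^ 2)) (x y : E) :
    ‖gradient f y - gradient f x - μ • (y - x)‖ ^ 2 ≤
      (L - μ) * inner ℝ (gradient f y - gradient f x - μ • (y - x)) (y - x) := by
  have key : ∀ (x y : E) (s : ℝ),
      f x + inner ℝ (gradient f x) (y - x) + μ / 2 * ‖y - x‖ ^ 2 +
        (s - (L - μ) / 2 * s ^ 2) * ‖gradient f y - gradient f x - μ • (y - x)‖ ^ 2 ≤ f y := by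
    intro x y s
    set d := gradient f y - gradient f x - μ • (y - x) with hd
    have h1 := add_inner_gradient_add_sq_le hf hconv x ((y - x) + (-s) • d)
    have h2 := le_add_inner_gradient_add_sq hf hsmooth y ((-s) • d)
    rw [show x + ((y - x) + (-s) • d) = y + (-s) • d by abel, norm_add_smul_sq_real,
      inner_add_right, real_inner_smul_right] at h1
    rw [real_inner_smul_right, norm_smul, mul_pow, Real.norm_eq_abs, sq_abs] at h2
    have h3 : ‖d‖ ^ 2 = inner ℝ (gradient f y) d - inner ℝ (gradient f x) d
        - μ * inner ℝ (y - x) d := by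
      rw [← real_inner_self_eq_norm_sq]
      nth_rewrite 1 [hd]
      rw [inner_sub_left, inner_sub_left, real_inner_smul_left]
    linear_combination h1 + h2 + s * h3
  set d := gradient f y - gradient f x - μ • (y - x) with hd
  have hsum : ∀ s : ℝ, (2 * s - (L - μ) * s ^ 2) * ‖d‖ ^ 2 ≤ inner ℝ d (y - x) := by
    intro s
    have h1 := key x y s
    have h2 := key y x s
    rw [← hd] at h1
    rw [show gradient f x - gradient f y - μ • (x - y) = -d by rw [hd]; module, norm_neg,
      ← neg_sub y x, inner_neg_right, norm_neg] at h2
    have h3 : inner ℝ d (y - x) = inner ℝ (gradient f y) (y - x) - inner ℝ (gradient f x) (y - x)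
        - μ * ‖y - x‖ ^ 2 := by
      rw [hd, inner_sub_left, inner_sub_left, real_inner_smul_left, real_inner_self_eq_norm_sq]
    linarith
  rcases hμL.eq_or_lt with h | h
  · subst h
    have h1 := hsum ((inner ℝ d (y - x) + 1) / (2 * ‖d‖ ^ 2))
    rcases (sq_nonneg ‖d‖).eq_or_lt with h0 | h0
    · rw [← h0]; simp
    · have h2 : (2 * ((inner ℝ d (y - x) + 1) / (2 * ‖d‖ ^ 2))) * ‖d‖ ^ 2
          = inner ℝ d (y - x) + 1 := by
        rw [← mul_div_assoc, mul_div_mul_left _ _ two_ne_zero, div_mul_cancel₀ _ h0.ne']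
      rw [sub_self, zero_mul, sub_zero, h2] at h1
      linarith
  · have hM : 0 < L - μ := sub_pos.2 h
    have h1 := mul_le_mul_of_nonneg_left (hsum (L - μ)⁻¹) hM.le
    have h2 : (L - μ) * ((2 * (L - μ)⁻¹ - (L - μ) * (L - μ)⁻¹ ^ 2) * ‖d‖ ^ 2) = ‖d‖ ^ 2 := by
      field_simp
      ring
    rwa [h2] at h1

/-- A gradient step with step size `2 / (L + μ)` contracts distances by `(L - μ) / (L + μ)`. -/
theorem norm_gradient_step_sub_le {f : E → ℝ} {L μ : ℝ} (hμ : 0 < μ) (hμL : μ ≤ L)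
    (hf : Differentiable ℝ f)
    (hsmooth : ∀ x y : E, ‖gradient f x - gradient f y‖ ≤ L * ‖x - y‖)
    (hconv : ConvexOn ℝ Set.univ (fun x : E => f x - μ / 2 * ‖x‖ ^ 2)) (x y : E) :
    ‖(y - (2 / (L + μ)) • gradient f y) - (x - (2 / (L + μ)) • gradient f x)‖ ≤
      (L - μ) / (L + μ) * ‖y - x‖ := by
  have hpos : 0 < L + μ := by linarith
  have hcoc := norm_gradient_sub_sq_le hμL hf hsmooth hconv x y
  set d := gradient f y - gradient f x - μ • (y - x) with hd
  have hstep : (y - (2 / (L + μ)) • gradient f y) - (x - (2 / (L + μ)) • gradient f x) =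
      (L + μ)⁻¹ • ((L - μ) • (y - x) + (-2 : ℝ) • d) := by
    rw [hd]
    match_scalars <;> field_simp <;> ring
  rw [hstep, norm_smul, Real.norm_of_nonneg (inv_pos.2 hpos).le, div_eq_inv_mul, mul_assoc]
  refine mul_le_mul_of_nonneg_left ?_ (inv_pos.2 hpos).le
  refine le_of_sq_le_sq ?_ (mul_nonneg (sub_nonneg.2 hμL) (norm_nonneg _))
  rw [norm_add_smul_sq_real, norm_smul, mul_pow, Real.norm_eq_abs, sq_abs, real_inner_smul_left,
    real_inner_comm]
  linarith

theorem gradient_eq_zero_of_forall_le {f : E → ℝ} {xs : E} (hmin : ∀ x, f xs ≤ f x) :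
    gradient f xs = 0 := by
  have h : IsLocalMin f xs := Filter.Eventually.of_forall hmin
  simp [gradient, h.fderiv_eq_zero]

end GradientStep

theorem eps_mul_sum_pow_le {σ ε : ℝ} (hσ : 0 ≤ σ) (hε : 0 < ε) (t : ℕ) :
    ε * ∑ τ ∈ Finset.range (t + 1), σ ^ τ * ε ^ (t - τ) ≤
      max σ ε ^ (t + 1) * (if σ = ε then (t : ℝ) + 1 else ε / |σ - ε|) := by
  split_ifs with h
  · subst h
    have hsum : ∑ τ ∈ Finset.range (t + 1), σ ^ τ * σ ^ (t - τ) = (t + 1) * σ ^ t := by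
      rw [Finset.sum_congr rfl (g := fun _ => σ ^ t)]
      · simp
      · intro τ hτ
        rw [← pow_add, Nat.add_sub_cancel' (Nat.lt_succ_iff.1 (Finset.mem_range.1 hτ))]
    rw [hsum, max_self]
    exact le_of_eq (by ring)
  · have habs : 0 < |σ - ε| := abs_pos.2 (sub_ne_zero.2 h)
    have hgeom := Commute.geom_sum₂_mul (Commute.all σ ε) (t + 1)
    simp only [Nat.add_sub_cancel] at hgeom
    have hS : 0 ≤ ∑ τ ∈ Finset.range (t + 1), σ ^ τ * ε ^ (t - τ) :=
      Finset.sum_nonneg fun τ _ => by positivity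
    rw [mul_div_assoc', le_div_iff₀ habs, mul_assoc, mul_comm _ ε]
    refine mul_le_mul_of_nonneg_left ?_ hε.le
    rw [← abs_of_nonneg hS, ← abs_mul, hgeom]
    have h1 : σ ^ (t + 1) ≤ max σ ε ^ (t + 1) := pow_le_pow_left₀ hσ (le_max_left _ _) _
    have h2 : ε ^ (t + 1) ≤ max σ ε ^ (t + 1) := pow_le_pow_left₀ hε.le (le_max_right _ _) _
    have h3 : 0 ≤ σ ^ (t + 1) := by positivity
    have h4 : 0 ≤ ε ^ (t + 1) := by positivity
    exact abs_le.2 ⟨by linarith, by linarith⟩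


/-- DQ-GD quantization-error bound. -/
theorem dqgd_quantization_error (n : ℕ) (hn : 1 ≤ n)
    (L μ D : ℝ) (hμ : 0 < μ) (hμL : μ ≤ L) (hD : 0 < D)
    (ηGD σGD : ℝ) (hηGD : ηGD = 2 / (L + μ)) (hσGD : σGD = (L - μ) / (L + μ))
    (f : EuclideanSpace ℝ (Fin n) → ℝ) (hf : Differentiable ℝ f)
    (hsmooth : ∀ x y : EuclideanSpace ℝ (Fin n),
      ‖gradient f x - gradient f y‖ ≤ L * ‖x - y‖)
    (hconv : ConvexOn ℝ Set.univ (fun x : EuclideanSpace ℝ (Fin n) => f x - μ / 2 * ‖x‖ ^ 2))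
    (xs : EuclideanSpace ℝ (Fin n)) (hmin : ∀ x, f xs ≤ f x)
    (q : EuclideanSpace ℝ (Fin n) → EuclideanSpace ℝ (Fin n))
    (ε : ℝ) (hε : 0 < ε)
    (hq : ∀ v : EuclideanSpace ℝ (Fin n), ‖v‖ ≤ 1 → ‖q v - v‖ ≤ ε)
    (xh u e : ℕ → EuclideanSpace ℝ (Fin n)) (r : ℕ → ℝ)
    (hr0 : r 0 = L * D)
    (hr : ∀ t : ℕ, r (t + 1) = σGD ^ (t + 1) * L * D + ε * r t)
    (hu0 : u 0 = gradient f (xh 0))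
    (hu : ∀ t : ℕ, u (t + 1) = gradient f (xh (t + 1) + ηGD • e t) - e t)
    (he : ∀ t : ℕ, e t = r t • q ((r t)⁻¹ • u t) - u t)
    (hxh : ∀ t : ℕ, xh (t + 1) = xh t - ηGD • (u t + e t))
    (hinit : ‖xs - xh 0‖ ≤ D)
    (b : ℕ → ℝ)
    (hb : ∀ s : ℕ, b s = if σGD = ε then (s : ℝ) + 1 else ε / |σGD - ε|) :
    ∀ t : ℕ, ‖u t‖ ≤ r t ∧ ‖e t‖ ≤ ε * r t ∧
      r t = L * D * ∑ τ ∈ Finset.range (t + 1), σGD ^ τ * ε ^ (t - τ) ∧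
      ‖e t‖ ≤ max σGD ε ^ (t + 1) * L * D * b t := by
  have hL : 0 < L := hμ.trans_le hμL
  have hσ : 0 ≤ σGD := hσGD ▸ div_nonneg (sub_nonneg.2 hμL) (by linarith)
  have hrpos : ∀ t, 0 < r t := by
    intro t
    induction t with
    | zero => rw [hr0]; positivity
    | succ t ih => rw [hr]; positivity
  have hgs : gradient f xs = 0 := gradient_eq_zero_of_forall_le hmin
  have hcontr : ∀ z, ‖z - ηGD • gradient f z - xs‖ ≤ σGD * ‖z - xs‖ := by
    intro z
    have h := norm_gradient_step_sub_le hμ hμL hf hsmooth hconv xs z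
    rwa [hgs, smul_zero, sub_zero, ← hηGD, ← hσGD] at h
  have hgrad : ∀ z, ‖gradient f z‖ ≤ L * ‖z - xs‖ := by
    intro z
    have h := hsmooth z xs
    rwa [hgs, sub_zero] at h
  -- The shifted iterates `xh (t + 1) + ηGD • e t` perform exact gradient descent.
  have hdist : ∀ t, ‖xh (t + 1) + ηGD • e t - xs‖ ≤ σGD ^ (t + 1) * D := by
    intro t
    induction t with
    | zero =>
      have heq : xh (0 + 1) + ηGD • e 0 = xh 0 - ηGD • gradient f (xh 0) := by
        rw [hxh, hu0]; module
      rw [heq, zero_add, pow_one]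
      refine (hcontr _).trans (mul_le_mul_of_nonneg_left ?_ hσ)
      rwa [norm_sub_rev]
    | succ t ih =>
      have heq : xh (t + 1 + 1) + ηGD • e (t + 1) = xh (t + 1) + ηGD • e t -
          ηGD • gradient f (xh (t + 1) + ηGD • e t) := by
        rw [hxh (t + 1), hu t]; module
      rw [heq, pow_succ' σGD (t + 1), mul_assoc]
      exact (hcontr _).trans (mul_le_mul_of_nonneg_left ih hσ)
  have hequ : ∀ t, ‖u t‖ ≤ r t → ‖e t‖ ≤ ε * r t := by
    intro t hut
    have hpos := hrpos t
    have h := hq ((r t)⁻¹ • u t) (by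
      rw [norm_smul, norm_inv, Real.norm_of_nonneg hpos.le, inv_mul_le_iff₀ hpos, mul_one]
      exact hut)
    have heq : e t = r t • (q ((r t)⁻¹ • u t) - (r t)⁻¹ • u t) := by
      rw [smul_sub, smul_inv_smul₀ hpos.ne', he]
    rw [heq, norm_smul, Real.norm_of_nonneg hpos.le, mul_comm]
    exact mul_le_mul_of_nonneg_right h hpos.le
  have hut : ∀ t, ‖u t‖ ≤ r t := by
    intro t
    induction t with
    | zero =>
      rw [hu0, hr0]
      refine (hgrad _).trans (mul_le_mul_of_nonneg_left ?_ hL.le)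
      rwa [norm_sub_rev]
    | succ t ih =>
      rw [hu, hr]
      refine (norm_sub_le _ _).trans (add_le_add ?_ (hequ t ih))
      refine (hgrad _).trans ((mul_le_mul_of_nonneg_left (hdist t) hL.le).trans_eq ?_)
      ring
  have hrsum : ∀ t, r t = L * D * ∑ τ ∈ Finset.range (t + 1), σGD ^ τ * ε ^ (t - τ) := by
    intro t
    induction t with
    | zero => simp [hr0]
    | succ t ih =>
      have hsum : ∑ τ ∈ Finset.range (t + 1), σGD ^ τ * ε ^ (t + 1 - τ) =
          ε * ∑ τ ∈ Finset.range (t + 1), σGD ^ τ * ε ^ (t - τ) := by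
        rw [Finset.mul_sum]
        refine Finset.sum_congr rfl fun τ hτ => ?_
        rw [Nat.succ_sub (Nat.lt_succ_iff.1 (Finset.mem_range.1 hτ)), pow_succ]
        ring
      rw [hr, ih, Finset.sum_range_succ _ (t + 1), hsum, Nat.sub_self]
      ring
  intro t
  refine ⟨hut t, hequ t (hut t), hrsum t, (hequ t (hut t)).trans ?_⟩
  rw [hrsum, hb]
  have h := mul_le_mul_of_nonneg_left (eps_mul_sum_pow_le hσ hε t) (mul_pos hL hD).le
  linarith
end

section
/- DQ-AGD trajectory lemma. Let f : E → ℝ be differentiable and η, γ ∈ ℝ. Let e : ℕ → E be any sequence of error vectors, with the conventions e_{−1} = e_{−2} := 0, and set m_t := e_{t−1} + γ·(e_{t−1} − e_{t−2}). Suppose sequences x̂, ŷ : ℕ → E satisfy ŷ_0 = x̂_0 and, for all t ≥ 0, ŷ_{t+1} = x̂_t − η·(∇f(x̂_t + η·m_t) − m_t + e_t) and x̂_{t+1} = ŷ_{t+1} + γ·(ŷ_{t+1} − ŷ_t). Let (x, y) be the unquantized AGD iterates: x_0 = x̂_0, y_0 = x_0, y_{t+1} = x_t − η·∇f(x_t),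 x_{t+1} = y_{t+1} + γ·(y_{t+1} − y_t). Then for every t ≥ 0, ŷ_t = y_t − η·e_{t−1} and x̂_t = x_t − η·m_t. -/
/-- DQ-AGD trajectory lemma. -/
theorem dqagd_trajectory (n : ℕ) (hn : 1 ≤ n)
    (f : EuclideanSpace ℝ (Fin n) → ℝ) (hf : Differentiable ℝ f)
    (η γ : ℝ)
    (e : ℤ → EuclideanSpace ℝ (Fin n))
    (he1 : e (-1) = 0) (he2 : e (-2) = 0)
    (m : ℕ → EuclideanSpace ℝ (Fin n))
    (hm : ∀ t : ℕ, m t = e ((t : ℤ) - 1) + γ • (e ((t : ℤ) - 1) - e ((t : ℤ) - 2)))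
    (xh yh : ℕ → EuclideanSpace ℝ (Fin n))
    (hyh0 : yh 0 = xh 0)
    (hyh : ∀ t : ℕ, yh (t + 1) =
      xh t - η • (gradient f (xh t + η • m t) - m t + e (t : ℤ)))
    (hxh : ∀ t : ℕ, xh (t + 1) = yh (t + 1) + γ • (yh (t + 1) - yh t))
    (x y : ℕ → EuclideanSpace ℝ (Fin n))
    (hx0 : x 0 = xh 0) (hy0 : y 0 = x 0)
    (hy : ∀ t : ℕ, y (t + 1) = x t - η • gradient f (x t))
    (hx : ∀ t : ℕ, x (t + 1) = y (t + 1) + γ • (y (t + 1) - y t)) :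
    ∀ t : ℕ, yh t = y t - η • e ((t : ℤ) - 1) ∧ xh t = x t - η • m t := by
  intro t
  induction t with
  | zero => simp [hm, he1, he2, hyh0, hy0, hx0]
  | succ t ih =>
    obtain ⟨ihy, ihx⟩ := ih
    have e₁ : ((t + 1 : ℕ) : ℤ) - 1 = t := by push_cast; ring
    have e₂ : ((t + 1 : ℕ) : ℤ) - 2 = t - 1 := by push_cast; ring
    have y_succ : yh (t + 1) = y (t + 1) - η • e (t : ℤ) := by
      rw [hyh, hy, ihx, sub_add_cancel]
      module
    refine ⟨by rw [e₁, y_succ], ?_⟩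
    rw [hxh, hx, hm, e₁, e₂, y_succ, ihy]
    module
end

section
/- Linear contraction factor of DQ-AGD (Theorem 2, per-instance form). Under the DQ-AGD algorithm with D > 0, the iterates satisfy limsup_{T→∞} ‖ŷ_T − x*‖^{1/T} ≤ max{σ_AGD, φ_+}, where φ_+ := (ε·(1+γ) + √(ε²·(1+γ)² + 4·ε·γ))/2. -/
section
variable {F : Type*} [NormedAddCommGroup F] [InnerProductSpace ℝ F] [CompleteSpace F]

theorem hasDerivAt_comp_add_smul_of_differentiable {f : F → ℝ} (hf : Differentiable ℝ f)
    (x h : F) (t : ℝ) :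
    HasDerivAt (fun t : ℝ => f (x + t • h)) (inner ℝ (gradient f (x + t • h)) h) t := by
  have h1 : HasDerivAt (fun t : ℝ => x + t • h) h t := by
    simpa using ((hasDerivAt_id t).smul_const h).const_add x
  have h2 := ((hf (x + t • h)).hasGradientAt.hasFDerivAt).comp_hasDerivAt t h1
  simpa [Function.comp_def] using h2

theorem le_add_inner_gradient_add_of_lipschitz {f : F → ℝ} (hf : Differentiable ℝ f) {L : ℝ}
    (hsmooth : ∀ x y, ‖gradient f x - gradient f y‖ ≤ L * ‖x - y‖) (x h : F) :
    f (x + h) ≤ f x + inner ℝ (gradient f x) h + L / 2 * ‖h‖ ^ 2 := by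
  let φ : ℝ → ℝ := fun t =>
    f (x + t • h) - t * inner ℝ (gradient f x) h - t ^ 2 * (L / 2 * ‖h‖ ^ 2)
  have hφ : ∀ t, HasDerivAt φ (inner ℝ (gradient f (x + t • h)) h - inner ℝ (gradient f x) h
      - t * (L * ‖h‖ ^ 2)) t := by
    intro t
    have h1 := ((hasDerivAt_comp_add_smul_of_differentiable hf x h t).sub
      ((hasDerivAt_id t).mul_const (inner ℝ (gradient f x) h))).sub
      ((hasDerivAt_pow 2 t).mul_const (L / 2 * ‖h‖ ^ 2))
    refine (show HasDerivAt φ _ t from h1).congr_deriv ?_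
    push_cast
    ring
  have hanti : AntitoneOn φ (Set.Icc 0 1) := by
    refine antitoneOn_of_deriv_nonpos (convex_Icc 0 1)
      (fun t _ => (hφ t).continuousAt.continuousWithinAt)
      (fun t _ => (hφ t).differentiableAt.differentiableWithinAt) fun t ht => ?_
    rw [interior_Icc] at ht
    rw [(hφ t).deriv, ← inner_sub_left]
    have h1 := real_inner_le_norm (gradient f (x + t • h) - gradient f x) h
    have h2 := hsmooth (x + t • h) x
    rw [add_sub_cancel_left, norm_smul, Real.norm_of_nonneg ht.1.le] at h2
    nlinarith [mul_le_mul_of_nonneg_right h2 (norm_nonneg h)]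
  have := hanti (Set.left_mem_Icc.2 zero_le_one) (Set.right_mem_Icc.2 zero_le_one) zero_le_one
  simp [φ] at this ⊢
  linarith

theorem add_inner_gradient_add_le_of_strongConvex {f : F → ℝ} (hf : Differentiable ℝ f) {μ : ℝ}
    (hconv : ConvexOn ℝ Set.univ (fun x : F => f x - μ / 2 * ‖x‖ ^ 2)) (x h : F) :
    f x + inner ℝ (gradient f x) h + μ / 2 * ‖h‖ ^ 2 ≤ f (x + h) := by
  let φ : ℝ → ℝ := fun t => f (x + t • h) - μ / 2 * ‖x + t • h‖ ^ 2
  have hφ : ConvexOn ℝ Set.univ φ := by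
    have h1 : φ = (fun x : F => f x - μ / 2 * ‖x‖ ^ 2) ∘
        (AffineMap.lineMap x (x + h) : ℝ →ᵃ[ℝ] F) := by
      ext t
      simp [φ, AffineMap.lineMap_apply, add_comm]
    rw [h1]
    exact hconv.comp_affineMap _
  have hd : HasDerivAt φ (inner ℝ (gradient f x) h - μ * inner ℝ x h) 0 := by
    have h1 : HasDerivAt (fun t : ℝ => x + t • h) h 0 := by
      simpa using ((hasDerivAt_id (0 : ℝ)).smul_const h).const_add x
    have h2 := (hasDerivAt_comp_add_smul_of_differentiable hf x h 0).sub
      (h1.norm_sq.const_mul (μ / 2))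
    refine (show HasDerivAt φ _ 0 from h2).congr_deriv ?_
    simp only [zero_smul, add_zero]
    ring
  have h3 := hφ.le_slope_of_hasDerivAt (Set.mem_univ 0) (Set.mem_univ 1) zero_lt_one hd
  simp [φ, slope_def_field, norm_add_sq_real] at h3 ⊢
  linarith

/-- One step of Nesterov's method with momentum `(1 - θ) / (1 + θ)`, `θ = √(μ / L)`, contracts the
Lyapunov function `f y - f xs + μ / 2 * ‖v - xs‖ ^ 2`, where `v = x + w` and `y = x - θ • w`. -/
theorem nesterov_lyapunov_step {f : F → ℝ} (hf : Differentiable ℝ f) {L μ θ : ℝ} (hμ : 0 < μ)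
    (hL : 0 < L) (hθ0 : 0 ≤ θ) (hθ1 : θ ≤ 1) (hθ : θ ^ 2 * L = μ)
    (hsmooth : ∀ x y, ‖gradient f x - gradient f y‖ ≤ L * ‖x - y‖)
    (hconv : ConvexOn ℝ Set.univ (fun x : F => f x - μ / 2 * ‖x‖ ^ 2)) (xs x w : F) :
    f (x - (1 / L) • gradient f x) - f xs
      + μ / 2 * ‖x + (1 - θ) • w - (θ / μ) • gradient f x - xs‖ ^ 2
      ≤ (1 - θ) * (f (x - θ • w) - f xs + μ / 2 * ‖x + w - xs‖ ^ 2) := by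
  set g := gradient f x with hg
  obtain ⟨d, rfl⟩ : ∃ d, x = xs + d := ⟨x - xs, by abel⟩
  have h1 := le_add_inner_gradient_add_of_lipschitz hf hsmooth (xs + d) (-((1 / L) • g))
  have h2 := add_inner_gradient_add_le_of_strongConvex hf hconv (xs + d) (-(θ • w))
  have h3 := add_inner_gradient_add_le_of_strongConvex hf hconv (xs + d) (-d)
  rw [← hg] at h1 h2 h3
  rw [← sub_eq_add_neg] at h1 h2
  rw [add_neg_cancel_right] at h3
  have e1 : xs + d + (1 - θ) • w - (θ / μ) • g - xs = d + (1 - θ) • w - (θ / μ) • g := by abel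
  have e2 : xs + d + w - xs = d + w := by abel
  rw [e1, e2]
  have hLi : (1 / L) = θ ^ 2 / μ := by field_simp; linarith
  have h4 : ‖d + (1 - θ) • w - (θ / μ) • g‖ ^ 2 = ‖d‖ ^ 2 + (1 - θ) ^ 2 * ‖w‖ ^ 2
      + (θ / μ) ^ 2 * ‖g‖ ^ 2 + 2 * (1 - θ) * inner ℝ d w - 2 * (θ / μ) * inner ℝ g d
      - 2 * (1 - θ) * (θ / μ) * inner ℝ g w := by
    rw [norm_sub_sq_real, norm_add_sq_real, norm_smul, norm_smul, mul_pow, mul_pow,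
      Real.norm_eq_abs, Real.norm_eq_abs, sq_abs, sq_abs]
    simp only [inner_add_left, real_inner_smul_left, real_inner_smul_right]
    rw [real_inner_comm g d, real_inner_comm g w]
    ring
  rw [h4, norm_add_sq_real]
  simp only [norm_neg, inner_neg_right, real_inner_smul_right, norm_smul, mul_pow,
    Real.norm_eq_abs, sq_abs, real_inner_self_eq_norm_sq] at h1 h2 h3
  have h5 : L / 2 * ((1 / L) ^ 2 * ‖g‖ ^ 2) = (1 / L) * ‖g‖ ^ 2 / 2 := by field_simp
  rw [h5] at h1
  have h6 : μ / 2 * ((θ / μ) ^ 2 * ‖g‖ ^ 2) = (1 / L) * ‖g‖ ^ 2 / 2 := by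
    rw [hLi]; field_simp
  have h7 : μ * (θ / μ) = θ := by field_simp
  have h8 := mul_le_mul_of_nonneg_left h2 (sub_nonneg.2 hθ1)
  have h9 := mul_le_mul_of_nonneg_left h3 hθ0
  have h10 : 0 ≤ μ / 2 * ((1 - θ) * (θ + θ ^ 2) * ‖w‖ ^ 2) := by
    have := sub_nonneg.2 hθ1
    positivity
  have h11 : μ / 2 * (2 * (θ / μ) * inner ℝ g d) = θ * inner ℝ g d := by
    linear_combination inner ℝ g d * h7
  have h12 : μ / 2 * (2 * (1 - θ) * (θ / μ) * inner ℝ g w) = (1 - θ) * θ * inner ℝ g w := by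
    linear_combination (1 - θ) * inner ℝ g w * h7
  linarith
/-- Linear convergence of Nesterov's accelerated gradient method on a smooth strongly convex
function. -/
theorem nesterov_norm_sq_le {f : F → ℝ} (hf : Differentiable ℝ f) {L μ θ γ : ℝ} (hμ : 0 < μ)
    (hL : 0 < L) (hθ0 : 0 < θ) (hθ1 : θ ≤ 1) (hθ : θ ^ 2 * L = μ) (hγ : γ = (1 - θ) / (1 + θ))
    (hsmooth : ∀ x y, ‖gradient f x - gradient f y‖ ≤ L * ‖x - y‖)
    (hconv : ConvexOn ℝ Set.univ (fun x : F => f x - μ / 2 * ‖x‖ ^ 2))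
    {xs : F} (hxs : gradient f xs = 0) {x y : ℕ → F} (h0 : y 0 = x 0)
    (hy : ∀ t, y (t + 1) = x t - (1 / L) • gradient f (x t))
    (hx : ∀ t, x (t + 1) = y (t + 1) + γ • (y (t + 1) - y t)) (t : ℕ) :
    ‖y t - xs‖ ^ 2 ≤ (L / μ + 1) * (1 - θ) ^ t * ‖x 0 - xs‖ ^ 2 := by
  have key : ∀ t, f (y t) - f xs + μ / 2 * ‖x t + (1 / θ) • (x t - y t) - xs‖ ^ 2
      ≤ (1 - θ) ^ t * ((L + μ) / 2 * ‖x 0 - xs‖ ^ 2) := by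
    intro t
    induction t with
    | zero =>
      have := le_add_inner_gradient_add_of_lipschitz hf hsmooth xs (x 0 - xs)
      rw [hxs, inner_zero_left, add_sub_cancel] at this
      rw [h0]
      simp only [sub_self, smul_zero, add_zero, pow_zero, one_mul]
      linarith
    | succ t ih =>
      have h1 := nesterov_lyapunov_step hf hμ hL hθ0.le hθ1 hθ hsmooth hconv xs (x t)
        ((1 / θ) • (x t - y t))
      have e1 : x t - θ • (1 / θ) • (x t - y t) = y t := by
        rw [smul_smul, mul_one_div_cancel hθ0.ne', one_smul, sub_sub_cancel]
      have e2 : x t + (1 - θ) • (1 / θ) • (x t - y t) - (θ / μ) • gradient f (x t)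
          = x (t + 1) + (1 / θ) • (x (t + 1) - y (t + 1)) := by
        have hμL : θ / μ = 1 / (L * θ) := by rw [← hθ]; field_simp
        rw [hx, hy, hγ, hμL]
        have : (1 + θ) ≠ 0 := by positivity
        match_scalars <;> field_simp <;> ring
      rw [e1, e2, ← hy] at h1
      refine h1.trans ?_
      rw [pow_succ' (1 - θ)]
      have := mul_le_mul_of_nonneg_left ih (sub_nonneg.2 hθ1)
      linarith
  have h1 := add_inner_gradient_add_le_of_strongConvex hf hconv xs (y t - xs)
  rw [hxs, inner_zero_left, add_sub_cancel] at h1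
  have h2 := key t
  have h3 : 0 ≤ μ / 2 * ‖x t + (1 / θ) • (x t - y t) - xs‖ ^ 2 := by positivity
  have h4 : μ / 2 * ‖y t - xs‖ ^ 2
      ≤ μ / 2 * ((L / μ + 1) * (1 - θ) ^ t * ‖x 0 - xs‖ ^ 2) := by
    have : μ / 2 * ((L / μ + 1) * (1 - θ) ^ t * ‖x 0 - xs‖ ^ 2)
        = (1 - θ) ^ t * ((L + μ) / 2 * ‖x 0 - xs‖ ^ 2) := by field_simp
    linarith
  exact le_of_mul_le_mul_left h4 (by positivity)

end

theorem norm_nesterov_extrapolation_sub_le {F : Type*} [NormedAddCommGroup F] [NormedSpace ℝ F]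
    {x y : ℕ → F} {xs : F} {γ σ C : ℝ} (hγ : 0 ≤ γ)
    (hσ : 0 < σ) (hC : 0 ≤ C) (h0 : y 0 = x 0)
    (hx : ∀ t, x (t + 1) = y (t + 1) + γ • (y (t + 1) - y t))
    (hy : ∀ t, ‖y t - xs‖ ≤ C * σ ^ t) (t : ℕ) :
    ‖x t - xs‖ ≤ (1 + γ + γ / σ) * C * σ ^ t := by
  cases t with
  | zero =>
    have h1 := hy 0
    have : 0 ≤ (γ + γ / σ) * C := by positivity
    rw [h0] at h1
    simp only [pow_zero, mul_one] at h1 ⊢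
    linarith
  | succ t =>
    have e1 : x (t + 1) - xs = (1 + γ) • (y (t + 1) - xs) - γ • (y t - xs) := by
      rw [hx]; module
    have h1 := norm_sub_le ((1 + γ) • (y (t + 1) - xs)) (γ • (y t - xs))
    rw [← e1, norm_smul, norm_smul, Real.norm_of_nonneg hγ,
      Real.norm_of_nonneg (by positivity : 0 ≤ 1 + γ)] at h1
    have h2 := mul_le_mul_of_nonneg_left (hy (t + 1)) (by positivity : 0 ≤ 1 + γ)
    have h3 := mul_le_mul_of_nonneg_left (hy t) hγ
    have e2 : (1 + γ + γ / σ) * C * σ ^ (t + 1)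
        = (1 + γ) * (C * σ ^ (t + 1)) + γ * (C * σ ^ t) := by
      field_simp
      ring
    linarith

theorem exists_le_mul_pow_of_linear_recurrence {a : ℕ → ℝ} {A σ b c ρ : ℝ} (hA : 0 ≤ A)
    (hσ : 0 ≤ σ) (hσρ : σ ≤ ρ) (hb : 0 ≤ b) (hc : 0 ≤ c) (hρ : b * ρ + c < ρ ^ 2)
    (h0 : a 0 = 0) (h1 : a 1 = 0)
    (ha : ∀ t, a (t + 2) = A * σ ^ t + b * a (t + 1) + c * a t) :
    ∃ C, 0 ≤ C ∧ ∀ t, a t ≤ C * ρ ^ t := by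
  have hd : 0 < ρ ^ 2 - (b * ρ + c) := sub_pos.2 hρ
  have hρ0 : 0 ≤ ρ := hσ.trans hσρ
  set C := A / (ρ ^ 2 - (b * ρ + c)) with hC
  have hC0 : 0 ≤ C := by positivity
  have hCA : A = C * (ρ ^ 2 - (b * ρ + c)) := (div_mul_cancel₀ A hd.ne').symm
  refine ⟨C, hC0, fun t => ?_⟩
  induction t using Nat.twoStepInduction with
  | zero => rw [h0]; positivity
  | one => rw [h1]; positivity
  | more t ih0 ih1 =>
    have h2 := mul_le_mul_of_nonneg_left (pow_le_pow_left₀ hσ hσρ t) hA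
    have h3 := mul_le_mul_of_nonneg_left ih0 hc
    have h4 := mul_le_mul_of_nonneg_left ih1 hb
    have h5 : C * ρ ^ (t + 2) = A * ρ ^ t + b * (C * ρ ^ (t + 1)) + c * (C * ρ ^ t) := by
      rw [hCA]; ring
    rw [ha]
    linarith

theorem limsup_rpow_one_div_le_of_le_mul_pow {a : ℕ → ℝ} {K ρ : ℝ} (ha : ∀ t, 0 ≤ a t)
    (hK : 0 < K) (hρ : 0 ≤ ρ) (h : ∀ t, a t ≤ K * ρ ^ t) :
    Filter.limsup (fun T : ℕ => a T ^ (1 / (T : ℝ))) Filter.atTop ≤ ρ := by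
  have hlim : Filter.Tendsto (fun T : ℕ => K ^ (1 / (T : ℝ)) * ρ) Filter.atTop (nhds ρ) := by
    have h1 : Filter.Tendsto (fun T : ℕ => K ^ (1 / (T : ℝ))) Filter.atTop (nhds (K ^ (0 : ℝ))) :=
      (Real.continuousAt_const_rpow hK.ne').tendsto.comp tendsto_one_div_atTop_nhds_zero_nat
    simpa using h1.mul_const ρ
  rw [← hlim.limsup_eq]
  refine Filter.limsup_le_limsup ?_ ?_ hlim.isBoundedUnder_le
  · filter_upwards [Filter.eventually_gt_atTop 0] with T hT
    have h1 := Real.rpow_le_rpow (ha T) (h T) (by positivity : 0 ≤ 1 / (T : ℝ))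
    rwa [Real.mul_rpow hK.le (by positivity), one_div, Real.pow_rpow_inv_natCast hρ hT.ne',
      ← one_div] at h1
  · exact Filter.isCoboundedUnder_le_of_le Filter.atTop
      (fun T => Real.rpow_nonneg (ha T) (1 / (T : ℝ)))

/-- The error of a quantizer of accuracy `ε` on the unit ball, rescaled to the ball of
radius `r`. -/
theorem norm_smul_quantizer_sub_le {F : Type*} [NormedAddCommGroup F] [NormedSpace ℝ F] {q : F → F}
    {ε : ℝ} (hq : ∀ v, ‖v‖ ≤ 1 → ‖q v - v‖ ≤ ε) {r : ℝ} (hr : 0 < r) {u : F} (hu : ‖u‖ ≤ r) :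
    ‖r • q (r⁻¹ • u) - u‖ ≤ ε * r := by
  have h1 : ‖r⁻¹ • u‖ ≤ 1 := by
    rw [norm_smul, norm_inv, Real.norm_of_nonneg hr.le]
    exact inv_mul_le_one_of_le₀ hu hr.le
  have h2 : r • q (r⁻¹ • u) - u = r • (q (r⁻¹ • u) - r⁻¹ • u) := by
    rw [smul_sub, smul_inv_smul₀ hr.ne']
  rw [h2, norm_smul, Real.norm_of_nonneg hr.le, mul_comm]
  exact mul_le_mul_of_nonneg_right (hq _ h1) hr.le

/-- Under error feedback, a dynamic range dominating the gradient norms plus the accumulated past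
quantization errors keeps every quantizer input in range. -/
theorem norm_quantization_error_le {F : Type*} [NormedAddCommGroup F] [NormedSpace ℝ F] {q : F → F}
    {ε γ : ℝ} (hε : 0 < ε) (hγ : 0 ≤ γ) (hq : ∀ v, ‖v‖ ≤ 1 → ‖q v - v‖ ≤ ε)
    {g : ℕ → F} {G : ℕ → ℝ} (hG0 : ∀ t, 0 < G t) (hg : ∀ t, ‖g t‖ ≤ G t)
    {u e : ℕ → F} {r : ℕ → ℝ} (he0 : e 0 = 0) (he1 : e 1 = 0) (hr0 : r 0 = 0) (hr1 : r 1 = 0)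
    (hr : ∀ t, r (t + 2) = G t + ε * (r (t + 1) + γ * (r (t + 1) + r t)))
    (hu : ∀ t, u t = g t - (e (t + 1) + γ • (e (t + 1) - e t)))
    (he : ∀ t, e (t + 2) = r (t + 2) • q ((r (t + 2))⁻¹ • u t) - u t) (t : ℕ) :
    ‖e t‖ ≤ ε * r t := by
  have key : ∀ t, 0 ≤ r t ∧ ‖e t‖ ≤ ε * r t := by
    intro t
    induction t using Nat.twoStepInduction with
    | zero => simp [he0, hr0]
    | one => simp [he1, hr1]
    | more t ih0 ih1 =>
      obtain ⟨hrt, het⟩ := ih0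
      obtain ⟨hrt1, het1⟩ := ih1
      have hpos : 0 < r (t + 2) := by
        rw [hr]
        have := hG0 t
        positivity
      refine ⟨hpos.le, ?_⟩
      rw [he]
      refine norm_smul_quantizer_sub_le hq hpos ?_
      rw [hu, hr]
      have h1 := norm_sub_le (g t) (e (t + 1) + γ • (e (t + 1) - e t))
      have h2 := norm_add_le (e (t + 1)) (γ • (e (t + 1) - e t))
      rw [norm_smul, Real.norm_of_nonneg hγ] at h2
      have h3 := mul_le_mul_of_nonneg_left ((norm_sub_le (e (t + 1)) (e t)).trans
        (add_le_add het1 het)) hγ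
      linarith [hg t]
  exact (key t).2


/-- Linear contraction factor of DQ-AGD (Theorem 2, per-instance form). -/
theorem dqagd_contraction_factor (n : ℕ) (hn : 1 ≤ n)
    (L μ D : ℝ) (hμ : 0 < μ) (hμL : μ < L) (hD : 0 < D)
    (κ η γ σAGD lam : ℝ)
    (hκ : κ = L / μ) (hη : η = 1 / L)
    (hγ : γ = (Real.sqrt κ - 1) / (Real.sqrt κ + 1))
    (hσ : σAGD = Real.sqrt (1 - 1 / Real.sqrt κ))
    (hlam : lam = (1 + γ + γ / σAGD) * Real.sqrt (κ + 1))
    (f : EuclideanSpace ℝ (Fin n) → ℝ) (hf : Differentiable ℝ f)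
    (hsmooth : ∀ x y : EuclideanSpace ℝ (Fin n),
      ‖gradient f x - gradient f y‖ ≤ L * ‖x - y‖)
    (hconv : ConvexOn ℝ Set.univ (fun x : EuclideanSpace ℝ (Fin n) => f x - μ / 2 * ‖x‖ ^ 2))
    (xs : EuclideanSpace ℝ (Fin n)) (hmin : ∀ x, f xs ≤ f x)
    (q : EuclideanSpace ℝ (Fin n) → EuclideanSpace ℝ (Fin n))
    (ε : ℝ) (hε : 0 < ε)
    (hq : ∀ v : EuclideanSpace ℝ (Fin n), ‖v‖ ≤ 1 → ‖q v - v‖ ≤ ε)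
    (xh yh u : ℕ → EuclideanSpace ℝ (Fin n))
    (e : ℤ → EuclideanSpace ℝ (Fin n)) (r : ℤ → ℝ)
    (he1 : e (-1) = 0) (he2 : e (-2) = 0) (hyh0 : yh 0 = xh 0)
    (hr1 : r (-1) = 0) (hr2 : r (-2) = 0)
    (hrrec : ∀ t : ℕ, r (t : ℤ) = σAGD ^ t * L * D * lam
      + ε * (r ((t : ℤ) - 1) + γ * (r ((t : ℤ) - 1) + r ((t : ℤ) - 2))))
    (m : ℕ → EuclideanSpace ℝ (Fin n))
    (hm : ∀ t : ℕ, m t = e ((t : ℤ) - 1) + γ • (e ((t : ℤ) - 1) - e ((t : ℤ) - 2)))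
    (hu : ∀ t : ℕ, u t = gradient f (xh t + η • m t) - m t)
    (he : ∀ t : ℕ, e (t : ℤ) = r (t : ℤ) • q ((r (t : ℤ))⁻¹ • u t) - u t)
    (hyh : ∀ t : ℕ, yh (t + 1) = xh t - η • (u t + e (t : ℤ)))
    (hxh : ∀ t : ℕ, xh (t + 1) = yh (t + 1) + γ • (yh (t + 1) - yh t))
    (hinit : ‖xs - xh 0‖ ≤ D)
    (φp φm : ℝ)
    (hφp : φp = (ε * (1 + γ) + Real.sqrt (ε ^ 2 * (1 + γ) ^ 2 + 4 * ε * γ)) / 2)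
    (hφm : φm = (ε * (1 + γ) - Real.sqrt (ε ^ 2 * (1 + γ) ^ 2 + 4 * ε * γ)) / 2) :
    Filter.limsup (fun T : ℕ => ‖yh T - xs‖ ^ (1 / (T : ℝ))) Filter.atTop
      ≤ max σAGD φp := by
  have hL : 0 < L := hμ.trans hμL
  have hκ1 : 1 < κ := by rw [hκ]; exact (one_lt_div hμ).2 hμL
  have hsκ : 1 < √κ := by rw [Real.lt_sqrt zero_le_one]; simpa using hκ1
  have hsκ0 : 0 < √κ := one_pos.trans hsκ
  set θ := 1 / √κ with hθdef
  have hθ0 : 0 < θ := by positivity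
  have hθ1 : θ < 1 := (div_lt_one hsκ0).2 hsκ
  have hθ : θ ^ 2 * L = μ := by
    rw [hθdef, div_pow, one_pow, Real.sq_sqrt (by linarith), hκ]
    field_simp
  have hγθ : γ = (1 - θ) / (1 + θ) := by
    rw [hγ, hθdef]; field_simp
  have hγ0 : 0 < γ := by
    rw [hγ]; exact div_pos (sub_pos.2 hsκ) (by positivity)
  have hσ0 : 0 < σAGD := by rw [hσ]; exact Real.sqrt_pos.2 (sub_pos.2 hθ1)
  have hσ2 : σAGD ^ 2 = 1 - θ := by rw [hσ]; exact Real.sq_sqrt (sub_nonneg.2 hθ1.le)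
  have hgrad : gradient f xs = 0 := by
    have : IsLocalMin f xs := Filter.Eventually.of_forall hmin
    rw [gradient, this.fderiv_eq_zero, map_zero]
  subst hη
  -- shifting the indices by two moves the integer-indexed sequences to `ℕ`
  obtain ⟨E, hE⟩ : ∃ E : ℕ → EuclideanSpace ℝ (Fin n), ∀ k : ℕ, E k = e ((k : ℤ) - 2) :=
    ⟨_, fun _ => rfl⟩
  obtain ⟨R, hR⟩ : ∃ R : ℕ → ℝ, ∀ k : ℕ, R k = r ((k : ℤ) - 2) := ⟨_, fun _ => rfl⟩
  have cast1 : ∀ t : ℕ, ((t + 1 : ℕ) : ℤ) - 2 = (t : ℤ) - 1 := fun t => by push_cast; ring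
  have cast2 : ∀ t : ℕ, ((t + 2 : ℕ) : ℤ) - 2 = (t : ℤ) := fun t => by push_cast; ring
  have hE1 : ∀ t : ℕ, E (t + 1) = e ((t : ℤ) - 1) := fun t => by rw [hE, cast1]
  have hE2 : ∀ t : ℕ, E (t + 2) = e (t : ℤ) := fun t => by rw [hE, cast2]
  have hR1 : ∀ t : ℕ, R (t + 1) = r ((t : ℤ) - 1) := fun t => by rw [hR, cast1]
  have hR2 : ∀ t : ℕ, R (t + 2) = r (t : ℤ) := fun t => by rw [hR, cast2]
  simp only [← hE2, ← hE1, ← hE, ← hR2, ← hR1, ← hR] at hrrec hm he hyh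
  have hE00 : E 0 = 0 := by rw [hE]; simpa using he2
  have hE01 : E 1 = 0 := by rw [hE]; simpa using he1
  have hR00 : R 0 = 0 := by rw [hR]; simpa using hr2
  have hR01 : R 1 = 0 := by rw [hR]; simpa using hr1
  -- the unquantized trajectory
  let x : ℕ → EuclideanSpace ℝ (Fin n) := fun t => xh t + (1 / L) • m t
  let y : ℕ → EuclideanSpace ℝ (Fin n) := fun t => yh t + (1 / L) • E (t + 1)
  have h0 : y 0 = x 0 := by simp [x, y, hm, hE00, hE01, hyh0]
  have hx0 : x 0 = xh 0 := by simp [x, hm, hE00, hE01]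
  have hy : ∀ t, y (t + 1) = x t - (1 / L) • gradient f (x t) := by
    intro t
    simp only [x, y, hyh, hu]
    module
  have hx : ∀ t, x (t + 1) = y (t + 1) + γ • (y (t + 1) - y t) := by
    intro t
    simp only [x, y, hxh, hm]
    module
  have hyb : ∀ t, ‖y t - xs‖ ≤ √(κ + 1) * D * σAGD ^ t := by
    intro t
    refine abs_le_of_sq_le_sq' ?_ (by positivity) |>.2
    refine (nesterov_norm_sq_le hf hμ hL hθ0 hθ1.le hθ hγθ hsmooth hconv hgrad h0 hy hx t).trans ?_
    rw [mul_pow, mul_pow, Real.sq_sqrt (by linarith), ← pow_mul, mul_comm t, pow_mul, hσ2, ← hκ,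
      mul_right_comm]
    have h1 : ‖x 0 - xs‖ ^ 2 ≤ D ^ 2 := by
      rw [hx0, norm_sub_rev]
      exact pow_le_pow_left₀ (norm_nonneg _) hinit 2
    have h2 : 0 ≤ (1 - θ) ^ t := pow_nonneg (sub_nonneg.2 hθ1.le) t
    gcongr
  have hg : ∀ t, ‖gradient f (x t)‖ ≤ σAGD ^ t * L * D * lam := by
    intro t
    have h1 := hsmooth (x t) xs
    rw [hgrad, sub_zero] at h1
    have h2 := norm_nesterov_extrapolation_sub_le hγ0.le hσ0 (by positivity) h0 hx hyb t
    have h3 := mul_le_mul_of_nonneg_left h2 hL.le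
    rw [hlam]
    linarith
  have hlam0 : 0 < lam := by rw [hlam]; positivity
  have herr : ∀ t, ‖E t‖ ≤ ε * R t :=
    norm_quantization_error_le hε hγ0.le hq (fun t => by positivity) hg hE00 hE01 hR00 hR01
      hrrec (fun t => by simp only [x, hu, hm]) he
  refine le_of_forall_gt_imp_ge_of_dense fun ρ hρ => ?_
  obtain ⟨hσρ, hφρ⟩ := max_lt_iff.1 hρ
  have hρ0 : 0 < ρ := hσ0.trans hσρ
  have hρquad : ε * (1 + γ) * ρ + ε * γ < ρ ^ 2 := by
    have hs := Real.sqrt_nonneg (ε ^ 2 * (1 + γ) ^ 2 + 4 * ε * γ)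
    have hs2 := Real.sq_sqrt (by positivity : 0 ≤ ε ^ 2 * (1 + γ) ^ 2 + 4 * ε * γ)
    have h1 : 0 < (ρ - φp) * (ρ - φm) := mul_pos (by linarith) (by linarith)
    rw [hφp, hφm] at h1
    nlinarith
  obtain ⟨C, hC0, hC⟩ := exists_le_mul_pow_of_linear_recurrence
    (by positivity : 0 ≤ L * D * lam) hσ0.le hσρ.le (by positivity : 0 ≤ ε * (1 + γ))
    (by positivity : 0 ≤ ε * γ) hρquad hR00 hR01 (fun t => by rw [hrrec]; ring)
  refine limsup_rpow_one_div_le_of_le_mul_pow (K := √(κ + 1) * D + 1 / L * (ε * (C * ρ)))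
    (fun t => norm_nonneg _) (by positivity) hρ0.le fun t => ?_
  have e1 : yh t - xs = (y t - xs) - (1 / L) • E (t + 1) := by simp only [y]; abel
  have h1 := norm_sub_le (y t - xs) ((1 / L) • E (t + 1))
  rw [← e1, norm_smul, Real.norm_of_nonneg (by positivity)] at h1
  calc ‖yh t - xs‖ ≤ ‖y t - xs‖ + 1 / L * ‖E (t + 1)‖ := h1
    _ ≤ √(κ + 1) * D * ρ ^ t + 1 / L * (ε * (C * ρ ^ (t + 1))) := by
      gcongr
      · exact (hyb t).trans (by gcongr)
      · exact (herr (t + 1)).trans (by gcongr; exact hC (t + 1))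
    _ = (√(κ + 1) * D + 1 / L * (ε * (C * ρ))) * ρ ^ t := by ring
end

section
/- DQ-HB trajectory lemma. Let f : E → ℝ be differentiable and η, γ ∈ ℝ. Let e : ℕ → E be any sequence of error vectors, with the conventions e_{−1} = e_{−2} := 0. Suppose x̂ : ℕ → E satisfies x̂_{−1} = x̂_0 and, for all t ≥ 0, x̂_{t+1} = x̂_t − η·(∇f(x̂_t + η·e_{t−1}) − [e_{t−1} + γ·(e_{t−1} − e_{t−2})] + e_t) + γ·(x̂_t − x̂_{t−1}). Let x be the unquantized heavy-ball iterates: x_{−1} = x_0 = x̂_0 and x_{t+1} = x_t − η·∇f(x_t) + γ·(x_t − x_{t−1}). Then for every t ≥ 0, x̂_t = x_t − η·e_{t−1}. -/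
/-- DQ-HB trajectory lemma. -/
theorem dqhb_trajectory (n : ℕ) (hn : 1 ≤ n)
    (f : EuclideanSpace ℝ (Fin n) → ℝ) (hf : Differentiable ℝ f)
    (η γ : ℝ)
    (e : ℤ → EuclideanSpace ℝ (Fin n))
    (he1 : e (-1) = 0) (he2 : e (-2) = 0)
    (xh : ℤ → EuclideanSpace ℝ (Fin n))
    (hxhm1 : xh (-1) = xh 0)
    (hxh : ∀ t : ℕ, xh ((t : ℤ) + 1) =
      xh (t : ℤ) - η • (gradient f (xh (t : ℤ) + η • e ((t : ℤ) - 1))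
        - (e ((t : ℤ) - 1) + γ • (e ((t : ℤ) - 1) - e ((t : ℤ) - 2))) + e (t : ℤ))
      + γ • (xh (t : ℤ) - xh ((t : ℤ) - 1)))
    (x : ℤ → EuclideanSpace ℝ (Fin n))
    (hxm1 : x (-1) = x 0) (hx0 : x 0 = xh 0)
    (hx : ∀ t : ℕ, x ((t : ℤ) + 1) =
      x (t : ℤ) - η • gradient f (x (t : ℤ)) + γ • (x (t : ℤ) - x ((t : ℤ) - 1))) :
    ∀ t : ℕ, xh (t : ℤ) = x (t : ℤ) - η • e ((t : ℤ) - 1) := by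
  suffices h : ∀ t : ℕ, xh (t : ℤ) = x (t : ℤ) - η • e ((t : ℤ) - 1) ∧
      xh ((t : ℤ) - 1) = x ((t : ℤ) - 1) - η • e ((t : ℤ) - 2) from fun t => (h t).1
  intro t
  induction t with
  | zero => simp [he1, he2, hxhm1, hxm1, hx0]
  | succ t ih =>
    obtain ⟨hcur, hprev⟩ := ih
    have hpred : ((t : ℤ) + 1) - 1 = t := by ring
    have hpred2 : ((t : ℤ) + 1) - 2 = t - 1 := by ring
    have hpt : xh (t : ℤ) + η • e ((t : ℤ) - 1) = x (t : ℤ) := by rw [hcur, sub_add_cancel]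
    push_cast
    rw [hpred, hpred2]
    refine ⟨?_, hcur⟩
    rw [hxh, hx, hpt, hcur, hprev]
    module
end

section
/- Comparison of subexponentially perturbed recurrences. Let α ≥ 0, σ ≥ 0, β ≥ 0, γ ≥ 0, A ≥ 0 be reals. Let r and r' be real sequences with r_{−2} = r_{−1} = r'_{−2} = r'_{−1} = 0 and, for all t ≥ 0, r_t = σ^t·max{t,1}^α·A + β·(r_{t−1} + γ·(r_{t−1} + r_{t−2})) and r'_t = σ^t·A + β·(r'_{t−1} + γ·(r'_{t−1} + r'_{t−2})). Then for every t ≥ 0, r_t ≤ max{t,1}^α·r'_t. -/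
/-- Comparison of subexponentially perturbed recurrences. -/
theorem perturbed_recurrence_comparison
    (α σ β γ A : ℝ) (hα : 0 ≤ α) (hσ : 0 ≤ σ) (hβ : 0 ≤ β) (hγ : 0 ≤ γ) (hA : 0 ≤ A)
    (r r' : ℤ → ℝ)
    (hr2 : r (-2) = 0) (hr1 : r (-1) = 0)
    (hr'2 : r' (-2) = 0) (hr'1 : r' (-1) = 0)
    (hr : ∀ t : ℕ, r (t : ℤ) = σ ^ t * (max (t : ℝ) 1) ^ α * A
      + β * (r ((t : ℤ) - 1) + γ * (r ((t : ℤ) - 1) + r ((t : ℤ) - 2))))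
    (hr' : ∀ t : ℕ, r' (t : ℤ) = σ ^ t * A
      + β * (r' ((t : ℤ) - 1) + γ * (r' ((t : ℤ) - 1) + r' ((t : ℤ) - 2)))) :
    ∀ t : ℕ, r (t : ℤ) ≤ (max (t : ℝ) 1) ^ α * r' (t : ℤ) := by
  set w : ℤ → ℝ := fun k ↦ (max (k : ℝ) 1) ^ α with hw
  have hw_mono : Monotone w := fun a b hab ↦
    Real.rpow_le_rpow (by positivity) (max_le_max_right 1 (by exact_mod_cast hab)) hα
  have hmono : ∀ a b : ℤ, a ≤ b → 0 ≤ r' a → r a ≤ w a * r' a → r a ≤ w b * r' a :=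
    fun a b hab h0 h ↦ h.trans (mul_le_mul_of_nonneg_right (hw_mono hab) h0)
  have step : ∀ t : ℕ, 0 ≤ r' ((t : ℤ) - 1) → 0 ≤ r' ((t : ℤ) - 2) →
      r ((t : ℤ) - 1) ≤ w ((t : ℤ) - 1) * r' ((t : ℤ) - 1) →
      r ((t : ℤ) - 2) ≤ w ((t : ℤ) - 2) * r' ((t : ℤ) - 2) →
      0 ≤ r' t ∧ r t ≤ w t * r' t := by
    intro t h1 h2 h3 h4
    have h3' := hmono _ t (by omega) h1 h3
    have h4' := hmono _ t (by omega) h2 h4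
    refine ⟨by rw [hr' t]; positivity, ?_⟩
    calc r t = σ ^ t * w t * A
          + β * (r ((t : ℤ) - 1) + γ * (r ((t : ℤ) - 1) + r ((t : ℤ) - 2))) := by
          simpa [hw] using hr t
      _ ≤ σ ^ t * w t * A + β * (w t * r' ((t : ℤ) - 1)
          + γ * (w t * r' ((t : ℤ) - 1) + w t * r' ((t : ℤ) - 2))) := by gcongr
      _ = w t * r' t := by rw [hr' t]; ring
  have window : ∀ t : ℕ,
      (0 ≤ r' ((t : ℤ) - 1) ∧ r ((t : ℤ) - 1) ≤ w ((t : ℤ) - 1) * r' ((t : ℤ) - 1)) ∧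
      (0 ≤ r' ((t : ℤ) - 2) ∧ r ((t : ℤ) - 2) ≤ w ((t : ℤ) - 2) * r' ((t : ℤ) - 2)) := by
    intro t
    induction t with
    | zero => simp [hr1, hr2, hr'1, hr'2]
    | succ t ih =>
      have e1 : ((t + 1 : ℕ) : ℤ) - 1 = t := by omega
      have e2 : ((t + 1 : ℕ) : ℤ) - 2 = t - 1 := by omega
      rw [e1, e2]
      exact ⟨step t ih.1.1 ih.2.1 ih.1.2 ih.2.2, ih.1⟩
  intro t
  obtain ⟨⟨h1, h3⟩, h2, h4⟩ := window t
  simpa [hw] using (step t h1 h2 h3 h4).2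
end

section
/- Worst-case problem instance for gradient descent. For every n ≥ 1, every x_0 ∈ E, every D > 0, all reals 0 < μ ≤ L, and every stepsize η > 0, there exists a differentiable function f : E → ℝ that is L-smooth and μ-strongly convex, with a minimizer x* satisfying ‖x_0 − x*‖ = D, such that the gradient-descent iterates x_{t+1} = x_t − η·∇f(x_t) starting at x_0 satisfy ‖x_{t+1} − x*‖ = max{|1 − η·μ|, |1 − η·L|}·‖x_t − x*‖ for all t ≥ 0. Moreover, max{|1 − η·μ|, |1 − η·L|} ≥ (L − μ)/(L + μ), with equality when η = 2/(L + μ). -/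
section IsotropicQuadratic

variable {F : Type*} [NormedAddCommGroup F] [InnerProductSpace ℝ F]

theorem hasGradientAt_half_mul_norm_sub_sq [CompleteSpace F] (c : ℝ) (a x : F) :
    HasGradientAt (fun y : F => c / 2 * ‖y - a‖ ^ 2) (c • (x - a)) x := by
  rw [hasGradientAt_iff_hasFDerivAt]
  have h := (((hasFDerivAt_id x).sub_const a).norm_sq).const_mul (c / 2)
  refine h.congr_fderiv ?_
  ext y
  simp
  ring

theorem convexOn_half_mul_norm_sub_sq_sub {c μ : ℝ} (h : μ ≤ c) (a : F) :
    ConvexOn ℝ Set.univ (fun x : F => c / 2 * ‖x - a‖ ^ 2 - μ / 2 * ‖x‖ ^ 2) := by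
  have hsq : ConvexOn ℝ Set.univ (fun x : F => ‖x‖ ^ 2) :=
    convexOn_univ_norm.pow (fun x _ => norm_nonneg x) 2
  have hlin : ConvexOn ℝ Set.univ (fun x : F => ((-c) • innerSL ℝ a) x) :=
    (((-c) • innerSL ℝ a : F →L[ℝ] ℝ) : F →ₗ[ℝ] ℝ).convexOn convex_univ
  have hsum := ((hsq.smul (by linarith : 0 ≤ (c - μ) / 2)).add hlin).add_const (c / 2 * ‖a‖ ^ 2)
  refine hsum.congr fun x _ => ?_
  simp only [Pi.add_apply, smul_eq_mul, smul_apply, innerSL_apply_apply]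
  rw [norm_sub_sq_real, real_inner_comm a x]
  ring

end IsotropicQuadratic

theorem sub_div_add_le_max_abs_one_sub_mul {L μ : ℝ} (hμ : 0 < μ) (hL : 0 < L) (η : ℝ) :
    (L - μ) / (L + μ) ≤ max |1 - η * μ| |1 - η * L| := by
  set M := max |1 - η * μ| |1 - η * L|
  have h₁ : 1 - η * μ ≤ M := (le_abs_self _).trans (le_max_left _ _)
  have h₂ : -(1 - η * L) ≤ M := (neg_le_abs _).trans (le_max_right _ _)
  rw [div_le_iff₀ (by linarith)]
  nlinarith

theorem max_abs_one_sub_two_div_add_mul {L μ : ℝ} (hμ : 0 < μ) (hμL : μ ≤ L) :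
    max |1 - 2 / (L + μ) * μ| |1 - 2 / (L + μ) * L| = (L - μ) / (L + μ) := by
  have hs : 0 < L + μ := by linarith
  have h₁ : 1 - 2 / (L + μ) * μ = (L - μ) / (L + μ) := by field_simp; ring
  have h₂ : 1 - 2 / (L + μ) * L = -((L - μ) / (L + μ)) := by field_simp; ring
  rw [h₁, h₂, abs_neg, max_self, abs_of_nonneg (div_nonneg (by linarith) hs.le)]


/-- Worst-case problem instance for gradient descent. -/
theorem gd_worst_case_instance (n : ℕ) (hn : 1 ≤ n)
    (x0 : EuclideanSpace ℝ (Fin n)) (D : ℝ) (hD : 0 < D)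
    (L μ : ℝ) (hμ : 0 < μ) (hμL : μ ≤ L) (η : ℝ) (hη : 0 < η) :
    (∃ f : EuclideanSpace ℝ (Fin n) → ℝ, Differentiable ℝ f ∧
      (∀ x y : EuclideanSpace ℝ (Fin n),
        ‖gradient f x - gradient f y‖ ≤ L * ‖x - y‖) ∧
      ConvexOn ℝ Set.univ (fun x : EuclideanSpace ℝ (Fin n) => f x - μ / 2 * ‖x‖ ^ 2) ∧
      ∃ xs : EuclideanSpace ℝ (Fin n), (∀ x, f xs ≤ f x) ∧ ‖x0 - xs‖ = D ∧
        ∀ x : ℕ → EuclideanSpace ℝ (Fin n), x 0 = x0 →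
          (∀ t : ℕ, x (t + 1) = x t - η • gradient f (x t)) →
          ∀ t : ℕ, ‖x (t + 1) - xs‖ = max |1 - η * μ| |1 - η * L| * ‖x t - xs‖) ∧
    (L - μ) / (L + μ) ≤ max |1 - η * μ| |1 - η * L| ∧
    (η = 2 / (L + μ) → max |1 - η * μ| |1 - η * L| = (L - μ) / (L + μ)) := by
  refine ⟨?_, sub_div_add_le_max_abs_one_sub_mul hμ (hμ.trans_le hμL) η, ?_⟩
  · obtain ⟨c, hμc, hcL, hc⟩ :
        ∃ c, μ ≤ c ∧ c ≤ L ∧ max |1 - η * μ| |1 - η * L| = |1 - η * c| := by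
      rcases max_choice |1 - η * μ| |1 - η * L| with h | h
      · exact ⟨μ, le_rfl, hμL, h⟩
      · exact ⟨L, hμL, le_rfl, h⟩
    have hc₀ : 0 ≤ c := hμ.le.trans hμc
    have : Nonempty (Fin n) := ⟨⟨0, hn⟩⟩
    obtain ⟨v, hv⟩ := exists_norm_eq (EuclideanSpace ℝ (Fin n)) hD.le
    have hgrad (x : EuclideanSpace ℝ (Fin n)) :
        gradient (fun y => c / 2 * ‖y - (x0 - v)‖ ^ 2) x = c • (x - (x0 - v)) :=
      (hasGradientAt_half_mul_norm_sub_sq c (x0 - v) x).gradient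
    refine ⟨fun y => c / 2 * ‖y - (x0 - v)‖ ^ 2,
      fun x => (hasGradientAt_half_mul_norm_sub_sq c (x0 - v) x).differentiableAt,
      fun x y => ?_, convexOn_half_mul_norm_sub_sq_sub hμc _, x0 - v, fun x => ?_, ?_, ?_⟩
    · rw [hgrad, hgrad, ← smul_sub, sub_sub_sub_cancel_right, norm_smul, Real.norm_of_nonneg hc₀]
      gcongr
    · simp only [sub_self, norm_zero]
      norm_num
      positivity
    · rw [sub_sub_cancel, hv]
    · intro x _ hx t
      have hstep : x (t + 1) - (x0 - v) = (1 - η * c) • (x t - (x0 - v)) := by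
        rw [hx t, hgrad]
        module
      rw [hstep, norm_smul, Real.norm_eq_abs, hc]
  · rintro rfl
    exact max_abs_one_sub_two_div_add_mul hμ hμL
end
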